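/- There exist statistics on four times that are Markovian for every measurement pattern yet are reproduced by no memoryless quantum dynamics: there do NOT exist a density matrix ρ₁ ∈ Matrix (Fin 2) (Fin 2) ℂ and completely positive trace-preserving maps Λ_2, Λ_3, Λ_4 on Matrix (Fin 2) (Fin 2) ℂ (each given by a finite Kraus family) such that for all x_1, x_2, x_3, x_4 ∈ Fin 2 both (i) tr[𝒫^{x_4}(Λ_4(𝒫^{x_3}(Λ_3(𝒫^{x_2}(Λ_2(𝒫^{x_1}(ρ₁)))))))] = 1/8 if x_3 = 0 and 0 otherwise, and (ii) tr[𝒫^{x_4}(Λ_4(𝒫^{x_3}(Λ_3(Λ_2(𝒫^{x_1}(ρ₁))))))] = 1/2 if x_3 = 0 and x_4 = 0, and 0 otherwise. -/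

import Mathlib

open Matrix ComplexOrder

noncomputable section

/-- Sharp projective measurement in the standard basis with outcome `x`:
`𝒫^x(A) = |x⟩⟨x| A |x⟩⟨x|`. -/
def measM (x : Fin 2) (A : Matrix (Fin 2) (Fin 2) ℂ) : Matrix (Fin 2) (Fin 2) ℂ :=
  Matrix.single x x 1 * A * Matrix.single x x 1

/-- A map on qubit matrices is completely positive and trace preserving, given by a
finite Kraus family: `Λ(A) = ∑ ℓ, L ℓ A (L ℓ)†` with `∑ ℓ, (L ℓ)† L ℓ = 1`. -/
def IsKrausCPTP (Λ : Matrix (Fin 2) (Fin 2) ℂ → Matrix (Fin 2) (Fin 2) ℂ) : Prop :=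
  ∃ (m : ℕ) (L : Fin m → Matrix (Fin 2) (Fin 2) ℂ),
    (∀ A, Λ A = ∑ ℓ, L ℓ * A * (L ℓ)ᴴ) ∧ (∑ ℓ, (L ℓ)ᴴ * L ℓ = 1)

/-- There exist statistics on four times that are Markovian for every measurement
pattern yet are reproduced by no memoryless quantum dynamics: no density matrix `ρ₁`
and CPTP maps `Λ₂, Λ₃, Λ₄` satisfy both (i) the quantum-regression-formula
prediction when all four times are measured equals `1/8` if `x₃ = 0` and `0`
otherwise, and (ii) the prediction when time `t₂` is not measured equals `1/2`
if `x₃ = 0` and `x₄ = 0`, and `0` otherwise. -/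
theorem incompatible_markov_statistics_no_memoryless_model :
    ¬ ∃ (ρ : Matrix (Fin 2) (Fin 2) ℂ)
        (Λ2 Λ3 Λ4 : Matrix (Fin 2) (Fin 2) ℂ → Matrix (Fin 2) (Fin 2) ℂ),
      ρ.PosSemidef ∧ ρ.trace = 1 ∧
      IsKrausCPTP Λ2 ∧ IsKrausCPTP Λ3 ∧ IsKrausCPTP Λ4 ∧
      ∀ x1 x2 x3 x4 : Fin 2,
        ((measM x4 (Λ4 (measM x3 (Λ3 (measM x2 (Λ2 (measM x1 ρ))))))).trace =
            if x3 = 0 then (1 / 8 : ℂ) else 0) ∧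
        ((measM x4 (Λ4 (measM x3 (Λ3 (Λ2 (measM x1 ρ)))))).trace =
            if x3 = 0 ∧ x4 = 0 then (1 / 2 : ℂ) else 0) := by
  rintro ⟨ρ, Λ2, Λ3, Λ4, -, -, -, -, ⟨m, L, hL, -⟩, h⟩
  have hm : ∀ A, measM 0 A = A 0 0 • Matrix.single 0 0 1 := by
    intro A
    ext i j
    fin_cases i <;> fin_cases j <;>
      simp [measM, Matrix.mul_apply, Fin.sum_univ_two, Matrix.single_apply]
  have hs : ∀ (c : ℂ) A, Λ4 (c • A) = c • Λ4 A := by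
    intro c A
    simp [hL, Finset.smul_sum]
  have ht : ∀ (x : Fin 2) (c : ℂ) A, (measM x (c • A)).trace = c * (measM x A).trace := by
    intro x c A
    simp [measM]
  have h1 := (h 0 0 0 1).1
  have h2 := (h 0 0 0 0).2
  have h3 := (h 0 0 0 1).2
  rw [hm (Λ3 _), hs, ht] at h1 h2 h3
  simp only [if_true, and_self, one_ne_zero, and_false, if_false] at h1 h2 h3
  rcases mul_eq_zero.mp h3 with h0 | h0
  · rw [h0] at h2
    norm_num at h2
  · rw [h0] at h1
    norm_num at h1
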